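/- arXiv:2305.15375 — 2 statements merged into one kernel-verified Lean document; each statement's English description precedes it below -/
import Mathlib

section
/- For every n×n complex matrix A and every subspace 𝒩 of ℂⁿ that is invariant for A (i.e. A𝒩 ⊆ 𝒩), there exists an n×n complex matrix N such that N commutes with A (NA = AN) and 𝒩 = ker N. -/
open Polynomial DirectSum

/-- The residue pairing: the top coefficient of the remainder modulo `g` does not vanish on
any nonzero ideal of `K[X] / (g)`. -/
lemma Polynomial.exists_linearMap_ker_dvd {K : Type*} [Field K] (g : K[X]) (hg : g ≠ 0) :
    ∃ φ : K[X] →ₗ[K] K, (∀ p, g ∣ p → φ p = 0) ∧ ∀ p, (∀ q, φ (p * q) = 0) → g ∣ p := by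
  obtain ⟨L, hL⟩ : ∃ L : K[X] →ₗ[K] K[X], ∀ p, L p = p % g :=
    ⟨modByMonicHom (g * C g.leadingCoeff⁻¹), fun p => mod_def.symm⟩
  refine ⟨(lcoeff K (g.natDegree - 1)).comp L, ?_, ?_⟩
  · intro p hp
    simp [hL, (EuclideanDomain.mod_eq_zero).2 hp]
  · intro p hp
    by_contra hgp
    have hr : p % g ≠ 0 := fun h => hgp ((EuclideanDomain.mod_eq_zero).1 h)
    have hlt : (p % g).natDegree < g.natDegree :=
      natDegree_lt_natDegree hr (EuclideanDomain.mod_lt p hg)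
    have key : (p * X ^ (g.natDegree - 1 - (p % g).natDegree)) % g
        = (p % g) * X ^ (g.natDegree - 1 - (p % g).natDegree) := by
      rw [mul_mod, ← (mod_eq_self_iff hg).2 (EuclideanDomain.mod_lt p hg), ← mul_mod,
        (mod_eq_self_iff hg).2 (EuclideanDomain.mod_lt p hg), mod_eq_self_iff hg]
      refine degree_lt_degree ?_
      rw [natDegree_mul_X_pow _ hr]
      omega
    have := hp (X ^ (g.natDegree - 1 - (p % g).natDegree))
    simp only [LinearMap.comp_apply, hL, lcoeff_apply, key] at this
    rw [coeff_mul_X_pow', if_pos (by omega)] at this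
    rw [show g.natDegree - 1 - (g.natDegree - 1 - (p % g).natDegree) = (p % g).natDegree by omega]
      at this
    exact hr (leadingCoeff_eq_zero.1 this)

lemma exists_form_quotient_span {K : Type*} [Field K] (g : K[X]) (hg : g ≠ 0) :
    ∃ B : (K[X] ⧸ K[X] ∙ g) →+ (K[X] ⧸ K[X] ∙ g) →+ K,
      (∀ (p : K[X]) x y, B (p • x) y = B x (p • y)) ∧
      (∀ (c : K) x y, B x ((C c : K[X]) • y) = c * B x y) ∧
      ∀ x, (∀ y, B x y = 0) → x = 0 := by
  obtain ⟨φ, h0, hφ⟩ := g.exists_linearMap_ker_dvd hg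
  let I : Ideal K[X] := Ideal.span {g}
  let ψ : (K[X] ⧸ I) →+ K := QuotientAddGroup.lift I.toAddSubgroup φ.toAddMonoidHom
    (fun p hp => h0 p (Ideal.mem_span_singleton.1 hp))
  have hψ : ∀ p, ψ (Ideal.Quotient.mk I p) = φ p := fun p => rfl
  let B : (K[X] ⧸ I) →+ (K[X] ⧸ I) →+ K := (AddMonoidHom.compHom ψ).comp AddMonoidHom.mul
  have hB : ∀ p q, B (Ideal.Quotient.mk I p) (Ideal.Quotient.mk I q) = φ (p * q) :=
    fun p q => rfl
  refine ⟨B, ?_, ?_, ?_⟩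
  · intro p x y
    obtain ⟨x, rfl⟩ := Ideal.Quotient.mk_surjective (I := I) x
    obtain ⟨y, rfl⟩ := Ideal.Quotient.mk_surjective (I := I) y
    change φ ((p * x) * y) = φ (x * (p * y))
    congr 1; ring
  · intro c x y
    obtain ⟨x, rfl⟩ := Ideal.Quotient.mk_surjective (I := I) x
    obtain ⟨y, rfl⟩ := Ideal.Quotient.mk_surjective (I := I) y
    change φ (x * (C c * y)) = c * φ (x * y)
    rw [← smul_eq_mul c, ← map_smul, smul_eq_C_mul]
    congr 1; ring
  · intro x hx
    obtain ⟨x, rfl⟩ := Ideal.Quotient.mk_surjective (I := I) x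
    exact Ideal.Quotient.eq_zero_iff_mem.2 (Ideal.mem_span_singleton.2
      (hφ x fun q => hx (Ideal.Quotient.mk I q)))

/-- Every endomorphism of a finite-dimensional space is self-adjoint for some
nondegenerate bilinear form. -/
lemma Module.End.exists_injective_bilin_selfAdjoint {K V : Type*} [Field K] [AddCommGroup V]
    [Module K V] [FiniteDimensional K V] (T : Module.End K V) :
    ∃ B : V →ₗ[K] V →ₗ[K] K,
      (∀ x y, B (T x) y = B x (T y)) ∧ Function.Injective B := by
  classical
  obtain ⟨ι, _, p, hp, k, ⟨e⟩⟩ := Module.equiv_directSum_of_isTorsion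
    (Module.AEval.isTorsion_of_finiteDimensional K V T)
  choose b hadj hC hinj using fun i =>
    exists_form_quotient_span (p i ^ k i) (pow_ne_zero _ (hp i).ne_zero)
  let f : V → ⨁ i, K[X] ⧸ K[X] ∙ p i ^ k i := fun v => e (Module.AEval.of K V T v)
  have f_add : ∀ x y, f (x + y) = f x + f y := fun x y => by simp [f]
  have f_smul : ∀ (c : K) x, f (c • x) = (C c : K[X]) • f x := fun c x => by
    simp only [f, map_smul, ← Module.AEval.C_smul]
  have f_T : ∀ x, f (T x) = (X : K[X]) • f x := fun x => by
    simp only [f, ← map_smul, Module.AEval.X_smul_of]; rfl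
  have f_surj : ∀ z, ∃ y, f y = z := fun z =>
    ⟨(Module.AEval.of K V T).symm (e.symm z), by simp [f]⟩
  refine ⟨LinearMap.mk₂ K (fun x y => ∑ i, b i (f x i) (f y i)) ?_ ?_ ?_ ?_, ?_, ?_⟩
  · intro x x' y
    simp [f_add, Finset.sum_add_distrib]
  · intro c x y
    simp [f_smul, DirectSum.smul_apply, hadj, hC, Finset.mul_sum]
  · intro x y y'
    simp [f_add, Finset.sum_add_distrib]
  · intro c x y
    simp [f_smul, DirectSum.smul_apply, hC, Finset.mul_sum]
  · intro x y
    simp [f_T, DirectSum.smul_apply, hadj]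
  · rw [injective_iff_map_eq_zero]
    intro x hx
    have hfx : f x = 0 := by
      ext1 i
      apply hinj i
      intro z
      obtain ⟨y, hy⟩ := f_surj (DirectSum.of (fun i => K[X] ⧸ K[X] ∙ p i ^ k i) i z)
      have h := LinearMap.congr_fun hx y
      simp only [LinearMap.mk₂_apply, LinearMap.zero_apply, hy] at h
      rw [Finset.sum_eq_single i] at h
      · simpa using h
      · intro j _ hj
        rw [DirectSum.of_eq_of_ne _ _ _ hj, map_zero]
      · simp
    simpa [f] using hfx

/-- Every invariant subspace of an endomorphism of a finite-dimensional space is the kernel of an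
element of its commutant. -/
lemma Module.End.exists_commute_ker_eq {K V : Type*} [Field K] [AddCommGroup V]
    [Module K V] [FiniteDimensional K V] (T : Module.End K V) (W : Submodule K V)
    (hW : W ≤ W.comap T) : ∃ N : Module.End K V, Commute N T ∧ LinearMap.ker N = W := by
  obtain ⟨B, hB, hBi⟩ := T.exists_injective_bilin_selfAdjoint
  obtain ⟨D, hD, hDi⟩ := Module.End.exists_injective_bilin_selfAdjoint (W.mapQ W T hW)
  let Φ : V ≃ₗ[K] (V →ₗ[K] K) :=
    LinearEquiv.ofInjectiveOfFinrankEq B hBi Subspace.dual_finrank_eq.symm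
  let E : V →ₗ[K] V →ₗ[K] K := D.compl₁₂ W.mkQ W.mkQ
  have hN : ∀ x y, B (Φ.symm (E x)) y = D (W.mkQ x) (W.mkQ y) := fun x y =>
    LinearMap.congr_fun (Φ.apply_symm_apply (E x)) y
  refine ⟨Φ.symm.toLinearMap ∘ₗ E, ?_, ?_⟩
  · ext x
    apply hBi
    ext y
    change B (Φ.symm (E (T x))) y = B (T (Φ.symm (E x))) y
    rw [hB, hN, hN]
    exact hD (W.mkQ x) (W.mkQ y)
  · ext x
    rw [LinearMap.mem_ker, ← W.ker_mkQ, LinearMap.mem_ker, ← map_eq_zero_iff D hDi]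
    simp only [LinearMap.comp_apply, LinearEquiv.coe_coe, map_eq_zero_iff _ Φ.symm.injective]
    constructor
    · intro h
      ext y
      exact LinearMap.congr_fun h y
    · intro h
      ext y
      exact LinearMap.congr_fun h (W.mkQ y)

/-- Halmos' theorem: every invariant subspace of an `n × n` complex matrix `A`
is the kernel of a matrix commuting with `A`. -/
theorem stmt_0 (n : ℕ) (A : Matrix (Fin n) (Fin n) ℂ)
    (𝒩 : Submodule ℂ (Fin n → ℂ))
    (hinv : ∀ v ∈ 𝒩, A.mulVec v ∈ 𝒩) :
    ∃ N : Matrix (Fin n) (Fin n) ℂ,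
      N * A = A * N ∧ 𝒩 = LinearMap.ker N.mulVecLin := by
  obtain ⟨N, hN, hker⟩ := Module.End.exists_commute_ker_eq A.mulVecLin 𝒩 hinv
  refine ⟨LinearMap.toMatrix' N, ?_, ?_⟩
  · have h := congrArg LinearMap.toMatrix' hN.eq
    simpa [LinearMap.toMatrix'_mul, ← Matrix.toLin'_apply'] using h
  · rw [← Matrix.toLin'_apply', Matrix.toLin'_toMatrix', hker]
end

section
/- For every n×n complex matrix A and every subspace 𝒩 of ℂⁿ that is invariant for A, there exists an n×n complex matrix R such that R commutes with A (RA = AR) and 𝒩 = range R (the column space of R). -/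
open Polynomial in
/-- A linear functional on `K[X] ⧸ (p ^ e)` whose kernel contains no nonzero ideal. -/
theorem exists_dual_quotient_span_pow {K : Type*} [Field K] {p : K[X]} (hp : Irreducible p)
    (e : ℕ) :
    ∃ φ : Module.Dual K (K[X] ⧸ Submodule.span K[X] {p ^ e}),
      ∀ a : K[X] ⧸ Ideal.span {p ^ e}, (∀ b, φ (a * b) = 0) → a = 0 := by
  classical
  let π := Ideal.Quotient.mk (Ideal.span {p ^ e})
  have hzero (q : K[X]) : π q = 0 ↔ p ^ e ∣ q := by
    rw [Ideal.Quotient.eq_zero_iff_mem, Ideal.mem_span_singleton]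
  obtain ⟨φ, hφ⟩ : ∃ φ : Module.Dual K (K[X] ⧸ Ideal.span {p ^ e}),
      φ (π (p ^ (e - 1))) = 0 → π (p ^ (e - 1)) = 0 := by
    by_contra! h
    exact (h 0).2 ((Module.forall_dual_apply_eq_zero_iff K _).mp fun φ => (h φ).1)
  refine ⟨φ, fun a ha => ?_⟩
  obtain ⟨r, rfl⟩ := Ideal.Quotient.mk_surjective a
  by_contra hr
  have hr' : ¬ p ^ e ∣ r := fun h => hr ((hzero r).mpr h)
  obtain ⟨j, hj, hassoc⟩ := (dvd_prime_pow hp.prime e).mp (EuclideanDomain.gcd_dvd_right r (p ^ e))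
  have hje : j ≠ e := by
    rintro rfl
    exact hr' (hassoc.symm.dvd.trans (EuclideanDomain.gcd_dvd_left r _))
  have hdvd : EuclideanDomain.gcd r (p ^ e) ∣ p ^ (e - 1) :=
    hassoc.dvd.trans (pow_dvd_pow p (by omega))
  obtain ⟨c, hc⟩ := hdvd
  have hmul : π r * π (EuclideanDomain.gcdA r (p ^ e) * c) = π (p ^ (e - 1)) := by
    rw [← map_mul, ← sub_eq_zero, ← map_sub, hzero, hc, EuclideanDomain.gcd_eq_gcd_ab]
    exact ⟨-(EuclideanDomain.gcdB r (p ^ e) * c), by ring⟩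
  have hdiv := (hzero _).mp (hφ (hmul ▸ ha _))
  have := (pow_dvd_pow_iff hp.ne_zero hp.not_isUnit).mp hdiv
  omega

open Polynomial in
/-- Every endomorphism of a finite-dimensional space is self-adjoint for some nondegenerate
bilinear form. -/
theorem exists_bilin_selfAdjoint {K V : Type*} [Field K] [AddCommGroup V] [Module K V]
    [FiniteDimensional K V] (T : Module.End K V) :
    ∃ B : V →ₗ[K] Module.Dual K V, Function.Injective B ∧ ∀ v w, B (T v) w = B v (T w) := by
  classical
  obtain ⟨ι, _, p, hp, e, ⟨f⟩⟩ :=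
    Module.equiv_directSum_of_isTorsion (R := K[X]) (M := Module.AEval' T)
      (Module.AEval.isTorsion_of_finiteDimensional K V T)
  choose φ hφ using fun i => exists_dual_quotient_span_pow (hp i) (e i)
  let g (i : ι) : V →ₗ[K] K[X] ⧸ Ideal.span {p i ^ e i} :=
    ((DirectSum.component K[X] ι (fun i => K[X] ⧸ Submodule.span K[X] {p i ^ e i}) i ∘ₗ
      f.toLinearMap).restrictScalars K) ∘ₗ (Module.AEval'.of T).toLinearMap
  have hgT (i : ι) (v : V) : g i (T v) = Ideal.Quotient.mk _ X * g i v := by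
    change f (Module.AEval'.of T (T v)) i = _
    rw [← Module.AEval'.X_smul_of, map_smul]
    rfl
  let B : V →ₗ[K] Module.Dual K V :=
    ∑ i, ((LinearMap.mul K (K[X] ⧸ Ideal.span {p i ^ e i})).compl₁₂ (g i) (g i)).compr₂ (φ i)
  have hB (v w : V) : B v w = ∑ i, φ i (g i v * g i w) := by
    simp only [B, LinearMap.sum_apply]
    rfl
  refine ⟨B, (injective_iff_map_eq_zero B).mpr fun v hv => ?_, fun v w => ?_⟩
  · suffices h : f (Module.AEval'.of T v) = 0 by simpa using h
    refine DFinsupp.ext fun i => hφ i _ fun b => ?_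
    let w : V := (Module.AEval'.of T).symm (f.symm (DirectSum.lof K[X] ι _ i b))
    have hw (j : ι) : g j w =
        DirectSum.lof K[X] ι (fun i => K[X] ⧸ Submodule.span K[X] {p i ^ e i}) i b j := by
      change f (Module.AEval'.of T w) j = _
      simp [w]
    have h0 : B v w = 0 := by simp [hv]
    rw [hB, Finset.sum_eq_single i] at h0
    · rw [hw, DirectSum.lof_apply] at h0
      exact h0
    · intro j _ hj
      rw [hw, DirectSum.lof_eq_of, DirectSum.of_eq_of_ne _ _ _ hj]
      exact (congrArg (φ j) (mul_zero (g j v))).trans (map_zero _)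
    · simp
  · simp only [hB, hgT]
    exact Finset.sum_congr rfl fun i _ => congrArg (φ i) (by ring)

/-- Every invariant subspace of an endomorphism of a finite-dimensional space is the range of an
endomorphism commuting with it. -/
theorem exists_commute_range_eq {K V : Type*} [Field K] [AddCommGroup V] [Module K V]
    [FiniteDimensional K V] (T : Module.End K V) (N : Submodule K V) (hN : ∀ v ∈ N, T v ∈ N) :
    ∃ S : Module.End K V, S * T = T * S ∧ LinearMap.range S = N := by
  obtain ⟨B, hB, hBT⟩ := exists_bilin_selfAdjoint T
  obtain ⟨C, hC, hCT⟩ := exists_bilin_selfAdjoint (T.restrict hN)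
  let eB := LinearEquiv.ofInjectiveOfFinrankEq B hB Subspace.dual_finrank_eq.symm
  let eC := LinearEquiv.ofInjectiveOfFinrankEq C hC Subspace.dual_finrank_eq.symm
  let S : V →ₗ[K] N := eC.symm.toLinearMap ∘ₗ N.subtype.dualMap ∘ₗ eB.toLinearMap
  have hS (v : V) (w : N) : C (S v) w = B v w :=
    LinearMap.congr_fun (eC.apply_symm_apply (N.subtype.dualMap (eB v))) w
  have hsurj : Function.Surjective S :=
    eC.symm.surjective.comp
      ((LinearMap.dualMap_surjective_of_injective N.injective_subtype).comp eB.surjective)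
  have hcomm (v : V) : S (T v) = T.restrict hN (S v) := by
    refine hC (LinearMap.ext fun w => ?_)
    rw [hS, hBT, hCT, hS]
    rfl
  refine ⟨N.subtype ∘ₗ S, LinearMap.ext fun v => congrArg Subtype.val (hcomm v), ?_⟩
  rw [LinearMap.range_comp_of_range_eq_top _ (LinearMap.range_eq_top.mpr hsurj),
    Submodule.range_subtype]

/-- Every invariant subspace of an `n × n` complex matrix `A`
is the range of a matrix commuting with `A`. -/
theorem stmt_1 (n : ℕ) (A : Matrix (Fin n) (Fin n) ℂ)
    (𝒩 : Submodule ℂ (Fin n → ℂ))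
    (hinv : ∀ v ∈ 𝒩, A.mulVec v ∈ 𝒩) :
    ∃ R : Matrix (Fin n) (Fin n) ℂ,
      R * A = A * R ∧ 𝒩 = LinearMap.range R.mulVecLin := by
  obtain ⟨S, hcomm, hrange⟩ := exists_commute_range_eq (Matrix.toLin' A) 𝒩 hinv
  refine ⟨LinearMap.toMatrix' S, ?_, ?_⟩
  · simpa only [LinearMap.toMatrix'_mul, LinearMap.toMatrix'_toLin'] using
      congrArg LinearMap.toMatrix' hcomm
  · rw [← Matrix.toLin'_apply', Matrix.toLin'_toMatrix', hrange]
end
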